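/- arXiv:2211.06311 — 3 statements merged into one kernel-verified Lean document; each statement's English description precedes it below -/
import Mathlib

section
/- There exists a function C₂ : ℕ → ℝ such that for every integer n ≥ 1 the following holds. Let 0 < η₀ ≤ η₁ and let M ∈ M(n) be such that for all i ≠ j either M_{ij} = 0 or η₀ < |M_{ij}| < η₁. Then for every v in the range of the linear map x ↦ Mx on ℝ^n, there exists x̂ ∈ ℝ^n with M x̂ = v and max_{1≤i≤n} |x̂_i| ≤ C₂(n)·η₁^{n−2}·η₀^{−(n−1)}·max_{1≤i≤n}|v_i|. Moreover, if {1,…,n} = I₁ ∪ … ∪ I_m is any partition into nonempty pairwise disjoint sets such that each diagonal submatrix M(I_k,I_k) is irreducible and M(I_k,I_l) = 0 whenever k ≠ l, then there is exactly one solution x̂ of M x̂ = v satisfying Σ_{i∈I_k} x̂_i = 0 for every k, and this solution obeys the bound above. -/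
/-- `M(n)`: discrete diffusion operators, i.e. real `n × n` matrices with nonpositive
off-diagonal entries and vanishing row and column sums. -/
def IsDiffusionMatrix {n : ℕ} (M : Matrix (Fin n) (Fin n) ℝ) : Prop :=
  (∀ i j, i ≠ j → M i j ≤ 0) ∧ (∀ i, ∑ l, M i l = 0) ∧ (∀ i, ∑ l, M l i = 0)

/-- The submatrix of `M` on an index set `I` is irreducible: for every nonempty proper
subset `S` of `I` there is a nonzero entry from `S` to `I \ S`. -/
def IrreducibleOn {n : ℕ} (M : Matrix (Fin n) (Fin n) ℝ) (I : Finset (Fin n)) : Prop :=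
  ∀ S : Finset (Fin n), S ⊆ I → S.Nonempty → S ≠ I → ∃ i ∈ S, ∃ j ∈ I \ S, M i j ≠ 0


open Finset in
lemma osc_aux {n : ℕ} (M : Matrix (Fin n) (Fin n) ℝ) (I : Finset (Fin n))
    (hI : ∀ S : Finset (Fin n), S ⊆ I → S.Nonempty → S ≠ I →
      ∃ i ∈ S, ∃ j ∈ I \ S, M i j ≠ 0 ∨ M j i ≠ 0)
    (x : Fin n → ℝ) (δ : ℝ) (hδ : 0 ≤ δ)
    (hx : ∀ i j, M i j ≠ 0 → |x i - x j| ≤ δ) (p q : Fin n) (hp : p ∈ I) (hq : q ∈ I) :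
    |x p - x q| ≤ n * δ := by
  classical
  have key : ∀ k : ℕ, I.filter (fun i => |x i - x q| ≤ k * δ) = I ∨
      k + 1 ≤ (I.filter (fun i => |x i - x q| ≤ k * δ)).card := by
    intro k
    induction k with
    | zero =>
      right
      have : 0 < (I.filter (fun i => |x i - x q| ≤ (0 : ℕ) * δ)).card :=
        Finset.card_pos.2 ⟨q, by simp [hq]⟩
      omega
    | succ k ih =>
      have hsub : I.filter (fun i => |x i - x q| ≤ k * δ) ⊆
          I.filter (fun i => |x i - x q| ≤ (k + 1 : ℕ) * δ) := by
        intro i hi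
        simp only [mem_filter] at hi ⊢
        refine ⟨hi.1, ?_⟩
        push_cast
        linarith [hi.2]
      by_cases he : I.filter (fun i => |x i - x q| ≤ k * δ) = I
      · left
        apply subset_antisymm (filter_subset _ _)
        rw [he] at hsub
        exact hsub
      · right
        have ih' := ih.resolve_left he
        obtain ⟨i, hi, j, hj, hij⟩ := hI _ (filter_subset _ _)
          (Finset.card_pos.1 (by omega)) he
        have hd : |x j - x i| ≤ δ := by
          rcases hij with h | h
          · rw [abs_sub_comm]; exact hx i j h
          · exact hx j i h
        rw [mem_sdiff] at hj
        have : I.filter (fun i => |x i - x q| ≤ k * δ) ⊂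
          I.filter (fun i => |x i - x q| ≤ (k + 1 : ℕ) * δ) := by
          refine (ssubset_iff_of_subset hsub).2 ⟨j, ?_, hj.2⟩
          simp only [mem_filter] at hi ⊢
          refine ⟨hj.1, ?_⟩
          push_cast
          have := abs_sub_le (x j) (x i) (x q)
          linarith [hi.2]
        have := card_lt_card this
        omega
  rcases key n with h | h
  · have : p ∈ I.filter (fun i => |x i - x q| ≤ n * δ) := by rw [h]; exact hp
    exact (mem_filter.1 this).2
  · have := card_le_univ (I.filter (fun i => |x i - x q| ≤ n * δ))
    simp at this
    omega

lemma energy_aux {n : ℕ} (M : Matrix (Fin n) (Fin n) ℝ) (hM : IsDiffusionMatrix M)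
    (x : Fin n → ℝ) :
    ∑ i, ∑ j, (-M i j) * (x i - x j) ^ 2 = 2 * ∑ i, x i * M.mulVec x i := by
  obtain ⟨-, hr, hc⟩ := hM
  have h1 : ∑ i, ∑ j, M i j * x i ^ 2 = 0 := by
    simp [← Finset.sum_mul, hr]
  have h2 : ∑ i, ∑ j, M i j * x j ^ 2 = 0 := by
    rw [Finset.sum_comm]
    simp [← Finset.sum_mul, hc]
  have h3 : ∑ i, x i * M.mulVec x i = ∑ i, ∑ j, x i * M i j * x j := by
    simp only [Matrix.mulVec, dotProduct, Finset.mul_sum, mul_assoc]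
  have h4 : ∑ i, ∑ j, (-M i j) * (x i - x j) ^ 2 = 2 * (∑ i, ∑ j, x i * M i j * x j)
      - ∑ i, ∑ j, M i j * x i ^ 2 - ∑ i, ∑ j, M i j * x j ^ 2 := by
    simp only [Finset.mul_sum, ← Finset.sum_sub_distrib]
    refine Finset.sum_congr rfl fun i _ => Finset.sum_congr rfl fun j _ => by ring
  rw [h4, h1, h2, h3]; ring

lemma bound_aux {n : ℕ} {κ : Type*} (η₀ : ℝ) (h0 : 0 < η₀)
    (M : Matrix (Fin n) (Fin n) ℝ) (hM : IsDiffusionMatrix M)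
    (hη : ∀ i j, i ≠ j → M i j = 0 ∨ η₀ < |M i j|)
    (I : κ → Finset (Fin n)) (hcov : ∀ i, ∃ k, i ∈ I k)
    (hI : ∀ k, ∀ S : Finset (Fin n), S ⊆ I k → S.Nonempty → S ≠ I k →
      ∃ i ∈ S, ∃ j ∈ I k \ S, M i j ≠ 0 ∨ M j i ≠ 0)
    (x : Fin n → ℝ) (V : ℝ) (hV : ∀ i, |M.mulVec x i| ≤ V)
    (hs : ∀ k, ∑ i ∈ I k, x i = 0) (i : Fin n) : |x i| ≤ 2 * n ^ 3 * V / η₀ := by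
  have : Nonempty (Fin n) := ⟨i⟩
  obtain ⟨p, hp⟩ := Finite.exists_max (fun i => |x i|)
  refine (hp i).trans ?_
  set X := |x p| with hX
  have hX0 : 0 ≤ X := abs_nonneg _
  have hV0 : 0 ≤ V := (abs_nonneg _).trans (hV i)
  have hn : (0:ℝ) ≤ n := Nat.cast_nonneg n
  have hE : ∑ i, ∑ j, (-M i j) * (x i - x j) ^ 2 ≤ 2 * n * X * V := by
    rw [energy_aux M hM x]
    have : ∑ i, x i * M.mulVec x i ≤ ∑ i : Fin n, X * V := by
      refine Finset.sum_le_sum fun i _ => ?_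
      refine (le_abs_self _).trans ?_
      rw [abs_mul]
      exact mul_le_mul (hp i) (hV i) (abs_nonneg _) hX0
    simp at this
    linarith
  have hnn : ∀ i j, 0 ≤ (-M i j) * (x i - x j) ^ 2 := by
    intro i j
    by_cases h : i = j
    · simp [h]
    · exact mul_nonneg (by linarith [hM.1 i j h]) (sq_nonneg _)
  have hedge : ∀ i j, M i j ≠ 0 → |x i - x j| ≤ √(2 * n * X * V / η₀) := by
    intro i j hij
    by_cases h : i = j
    · simp [h]
    apply Real.abs_le_sqrt
    rw [le_div_iff₀ h0]
    have h1 : (-M i j) * (x i - x j) ^ 2 ≤ ∑ i, ∑ j, (-M i j) * (x i - x j) ^ 2 :=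
      (Finset.single_le_sum (f := fun j => (-M i j) * (x i - x j) ^ 2)
        (fun j _ => hnn i j) (Finset.mem_univ j)).trans
      (Finset.single_le_sum (f := fun i => ∑ j, (-M i j) * (x i - x j) ^ 2)
        (fun i _ => Finset.sum_nonneg fun j _ => hnn i j) (Finset.mem_univ i))
    have h2 := (hη i j h).resolve_left hij
    rw [abs_of_nonpos (hM.1 i j h)] at h2
    have h3 := mul_le_mul_of_nonneg_right h2.le (sq_nonneg (x i - x j))
    linarith
  set δ := √(2 * n * X * V / η₀) with hδ
  have hδ0 : 0 ≤ δ := Real.sqrt_nonneg _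
  have hδ2 : δ ^ 2 = 2 * n * X * V / η₀ := Real.sq_sqrt (by positivity)
  obtain ⟨k, hk⟩ := hcov p
  have hosc := osc_aux M (I k) (hI k) x δ hδ0 hedge p
  have hXle : X ≤ n * δ := by
    rw [hX, abs_le]
    constructor
    · obtain ⟨q, hq, hq0⟩ : ∃ q ∈ I k, 0 ≤ x q := by
        by_contra! hcon
        exact absurd (hs k) (Finset.sum_neg hcon ⟨p, hk⟩).ne
      have := (abs_le.1 (hosc q hk hq)).1
      linarith
    · obtain ⟨q, hq, hq0⟩ : ∃ q ∈ I k, x q ≤ 0 := by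
        by_contra! hcon
        exact absurd (hs k) (Finset.sum_pos hcon ⟨p, hk⟩).ne'
      have := (abs_le.1 (hosc q hk hq)).2
      linarith
  rcases hX0.eq_or_lt with h | h
  · rw [← h]; positivity
  have hsq : X ^ 2 ≤ n ^ 2 * δ ^ 2 := by
    rw [← mul_pow]; exact pow_le_pow_left₀ hX0 hXle 2
  rw [hδ2] at hsq
  have : X * X ≤ X * (2 * n ^ 3 * V / η₀) := by
    calc X * X = X ^ 2 := by ring
      _ ≤ _ := hsq
      _ = _ := by ring
  exact le_of_mul_le_mul_left this h

lemma main_aux {n : ℕ} {κ : Type*} (η₀ : ℝ) (h0 : 0 < η₀)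
    (M : Matrix (Fin n) (Fin n) ℝ) (hM : IsDiffusionMatrix M)
    (hη : ∀ i j, i ≠ j → M i j = 0 ∨ η₀ < |M i j|)
    (v : Fin n → ℝ) (hv : v ∈ LinearMap.range M.mulVecLin)
    (I : κ → Finset (Fin n)) (hcov : ∀ i, ∃ k, i ∈ I k)
    (hdis : ∀ k l, k ≠ l → Disjoint (I k) (I l))
    (hI : ∀ k, ∀ S : Finset (Fin n), S ⊆ I k → S.Nonempty → S ≠ I k →
      ∃ i ∈ S, ∃ j ∈ I k \ S, M i j ≠ 0 ∨ M j i ≠ 0)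
    (hbl : ∀ k l, k ≠ l → ∀ i ∈ I k, ∀ j ∈ I l, M i j = 0) :
    ∃ x : Fin n → ℝ,
            (M.mulVec x = v ∧ ∀ k, ∑ i ∈ I k, x i = 0) ∧
            (∀ i, |x i| ≤ 2 * n ^ 3 * (⨆ i, |v i|) / η₀) ∧
            (∀ y : Fin n → ℝ,
              (M.mulVec y = v ∧ ∀ k, ∑ i ∈ I k, y i = 0) → y = x) := by
  choose c hc using hcov
  have hcu : ∀ k, ∀ i ∈ I k, c i = k := by
    intro k i hi
    by_contra h
    exact Finset.disjoint_left.1 (hdis _ _ h) (hc i) hi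
  obtain ⟨z, hz⟩ := hv
  rw [Matrix.mulVecLin_apply] at hz
  let a : κ → ℝ := fun k => (∑ i ∈ I k, z i) / (I k).card
  have hMa : M.mulVec (fun i => a (c i)) = 0 := by
    ext i
    have : ∀ j, M i j * a (c j) = M i j * a (c i) := by
      intro j
      by_cases h : c i = c j
      · rw [h]
      · rw [hbl _ _ h i (hc i) j (hc j)]; simp
    simp only [Matrix.mulVec, dotProduct, this, ← Finset.sum_mul, hM.2.1 i]
    simp
  have hx1 : M.mulVec (z - fun i => a (c i)) = v := by
    rw [Matrix.mulVec_sub, hMa, hz, sub_zero]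
  have hx2 : ∀ k, ∑ i ∈ I k, (z - fun i => a (c i)) i = 0 := by
    intro k
    have : ∑ i ∈ I k, a (c i) = ∑ i ∈ I k, a k :=
      Finset.sum_congr rfl fun i hi => by rw [hcu k i hi]
    simp only [Pi.sub_apply, Finset.sum_sub_distrib, this]
    rcases (I k).eq_empty_or_nonempty with h | h
    · simp [h]
    · have : ((I k).card : ℝ) ≠ 0 := by exact_mod_cast h.card_pos.ne'
      simp only [Finset.sum_const, nsmul_eq_mul, a]
      field_simp
      simp
  refine ⟨z - fun i => a (c i), ⟨hx1, hx2⟩, ?_, ?_⟩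
  · apply bound_aux η₀ h0 M hM hη I (fun i => ⟨c i, hc i⟩) hI _ _ _ hx2
    rw [hx1]
    intro i
    exact le_ciSup (f := fun i => |v i|) (Set.finite_range _).bddAbove i
  · rintro y ⟨hy1, hy2⟩
    have hd := bound_aux η₀ h0 M hM hη I (fun i => ⟨c i, hc i⟩) hI
      (y - (z - fun i => a (c i))) 0 (by
        rw [Matrix.mulVec_sub, hy1, hx1]; simp) (by
        intro k
        have h1 := hy2 k
        have h2 := hx2 k
        simp only [Pi.sub_apply _ (z - _), Finset.sum_sub_distrib (y)]
        rw [h1, h2, sub_zero])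
    ext i
    have h := hd i
    simp only [mul_zero, zero_div] at h
    have := abs_nonpos_iff.1 h
    rw [Pi.sub_apply] at this
    linarith

lemma const_aux {n : ℕ} (hn : 1 ≤ n) (η₀ η₁ : ℝ) (h0 : 0 < η₀) (h01 : η₀ ≤ η₁)
    (M : Matrix (Fin n) (Fin n) ℝ) (hM : IsDiffusionMatrix M)
    (v : Fin n → ℝ) (hv : v ∈ LinearMap.range M.mulVecLin) :
    2 * (n:ℝ) ^ 3 * (⨆ i, |v i|) / η₀ ≤
      2 * (n:ℝ) ^ 3 * η₁ ^ (n - 2) / η₀ ^ (n - 1) * ⨆ i, |v i| := by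
  have hV : 0 ≤ ⨆ i, |v i| := Real.iSup_nonneg fun i => abs_nonneg _
  rcases hn.eq_or_lt with h | h
  · subst h
    have : v = 0 := by
      obtain ⟨z, rfl⟩ := hv
      ext i
      have := hM.2.1 i
      simp at this
      simp [Matrix.mulVec, dotProduct, this]
    simp [this]
  · obtain ⟨m, rfl⟩ : ∃ m, n = m + 2 := ⟨n - 2, by omega⟩
    have e1 : m + 2 - 2 = m := rfl
    have e2 : m + 2 - 1 = m + 1 := rfl
    rw [e1, e2]
    have key : 1 / η₀ ≤ η₁ ^ m / η₀ ^ (m + 1) := by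
      rw [div_le_div_iff₀ h0 (by positivity), pow_succ, one_mul]
      gcongr
    calc 2 * ((m + 2 : ℕ):ℝ) ^ 3 * (⨆ i, |v i|) / η₀
        = (2 * ((m + 2 : ℕ):ℝ) ^ 3 * (⨆ i, |v i|)) * (1 / η₀) := by ring
      _ ≤ (2 * ((m + 2 : ℕ):ℝ) ^ 3 * (⨆ i, |v i|)) * (η₁ ^ m / η₀ ^ (m + 1)) := by gcongr
      _ = _ := by ring

/-- Quantitative maximum principle for discrete diffusion operators whose nonzero
off-diagonal entries lie in `(η₀, η₁)`. -/
theorem diffusion_maximum_principle :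
    ∃ C₂ : ℕ → ℝ, ∀ n : ℕ, 1 ≤ n →
      ∀ η₀ η₁ : ℝ, 0 < η₀ → η₀ ≤ η₁ →
      ∀ M : Matrix (Fin n) (Fin n) ℝ, IsDiffusionMatrix M →
      (∀ i j, i ≠ j → M i j = 0 ∨ (η₀ < |M i j| ∧ |M i j| < η₁)) →
      ∀ v : Fin n → ℝ, v ∈ LinearMap.range M.mulVecLin →
        (∃ x : Fin n → ℝ, M.mulVec x = v ∧
          ∀ i, |x i| ≤ C₂ n * η₁ ^ (n - 2) / η₀ ^ (n - 1) * ⨆ i, |v i|) ∧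
        (∀ (m : ℕ) (I : Fin m → Finset (Fin n)),
          (∀ k, (I k).Nonempty) →
          (∀ k l, k ≠ l → Disjoint (I k) (I l)) →
          Finset.univ.biUnion I = Finset.univ →
          (∀ k, IrreducibleOn M (I k)) →
          (∀ k l, k ≠ l → ∀ i ∈ I k, ∀ j ∈ I l, M i j = 0) →
          ∃ x : Fin n → ℝ,
            (M.mulVec x = v ∧ ∀ k, ∑ i ∈ I k, x i = 0) ∧
            (∀ i, |x i| ≤ C₂ n * η₁ ^ (n - 2) / η₀ ^ (n - 1) * ⨆ i, |v i|) ∧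
            (∀ y : Fin n → ℝ,
              (M.mulVec y = v ∧ ∀ k, ∑ i ∈ I k, y i = 0) → y = x)) := by
  classical
  refine ⟨fun n => 2 * (n:ℝ) ^ 3, ?_⟩
  intro n hn η₀ η₁ h0 h01 M hM hη v hv
  have hη' : ∀ i j, i ≠ j → M i j = 0 ∨ η₀ < |M i j| :=
    fun i j h => (hη i j h).imp id And.left
  have hC := const_aux hn η₀ η₁ h0 h01 M hM v hv
  constructor
  · let s : Setoid (Fin n) := Relation.EqvGen.setoid (fun i j => M i j ≠ 0)
    let I : Quotient s → Finset (Fin n) :=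
      fun k => Finset.univ.filter (fun i => Quotient.mk s i = k)
    obtain ⟨x, ⟨hx, -⟩, hb, -⟩ := main_aux η₀ h0 M hM hη' v hv I
      (fun i => ⟨Quotient.mk s i, by simp [I]⟩)
      (by
        intro k l hkl
        rw [Finset.disjoint_left]
        intro i hi hj
        simp only [I, Finset.mem_filter, Finset.mem_univ, true_and] at hi hj
        exact hkl (hi.symm.trans hj))
      (by
        intro k S hS hne hneq
        by_contra! hcon
        apply hneq
        refine Finset.Subset.antisymm hS ?_
        obtain ⟨p, hp⟩ := hne
        have hpk : Quotient.mk s p = k := by simpa [I] using hS hp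
        have step : ∀ i j, Relation.EqvGen (fun i j => M i j ≠ 0) i j →
            (i ∈ S ↔ j ∈ S) := by
          intro i j hij
          induction hij with
          | rel a b hab =>
            have hq : Quotient.mk s a = Quotient.mk s b :=
              Quotient.sound (Relation.EqvGen.rel a b hab)
            constructor
            · intro ha
              by_contra hb
              have : Quotient.mk s a = k := by simpa [I] using hS ha
              exact hab (hcon a ha b (by simp [I, hb, ← hq, this])).1
            · intro hb
              by_contra ha
              have : Quotient.mk s b = k := by simpa [I] using hS hb
              exact hab (hcon b hb a (by simp [I, ha, hq, this])).2
          | refl a => rfl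
          | symm a b _ ih => exact ih.symm
          | trans a b c _ _ ih1 ih2 => exact ih1.trans ih2
        intro q hq
        have hqk : Quotient.mk s q = k := by simpa [I] using hq
        exact (step p q (Quotient.exact (hpk.trans hqk.symm))).1 hp)
      (by
        intro k l hkl i hi j hj
        by_contra hij
        simp only [I, Finset.mem_filter, Finset.mem_univ, true_and] at hi hj
        apply hkl
        rw [← hi, ← hj]
        exact Quotient.sound (Relation.EqvGen.rel i j hij))
    exact ⟨x, hx, fun i => (hb i).trans hC⟩
  · intro m I _ hdis hcov hirr hbl
    obtain ⟨x, hx, hb, hu⟩ := main_aux η₀ h0 M hM hη' v hv I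
      (fun i => by
        have : i ∈ Finset.univ.biUnion I := by rw [hcov]; simp
        simpa using this)
      hdis
      (fun k S hS hne hneq => by
        obtain ⟨i, hi, j, hj, hij⟩ := hirr k S hS hne hneq
        exact ⟨i, hi, j, hj, Or.inl hij⟩)
      hbl
    exact ⟨x, hx, fun i => (hb i).trans hC, hu⟩
end

section
/- Let n ≥ 1 and let M ∈ M(n) be irreducible. Then the kernel of the linear map x ↦ Mx on ℝ^n is exactly the one-dimensional span of the all-ones vector (1,…,1), and the range of this linear map is exactly { y ∈ ℝ^n : Σ_{i=1}^n y_i = 0 }. -/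
/-- Kernel and range of an irreducible discrete diffusion operator. -/
theorem diffusion_irreducible_ker_range (n : ℕ) (hn : 1 ≤ n)
    (M : Matrix (Fin n) (Fin n) ℝ) (hM : IsDiffusionMatrix M)
    (hirr : IrreducibleOn M Finset.univ) :
    LinearMap.ker M.mulVecLin = Submodule.span ℝ {fun _ : Fin n => (1 : ℝ)} ∧
    (LinearMap.range M.mulVecLin : Set (Fin n → ℝ)) =
      {y : Fin n → ℝ | ∑ i, y i = 0} := by
  obtain ⟨hoff, hrow, hcol⟩ := hM
  have hne : Nonempty (Fin n) := ⟨⟨0, hn⟩⟩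
  have hker : LinearMap.ker M.mulVecLin = Submodule.span ℝ {fun _ : Fin n => (1 : ℝ)} := by
    ext x
    rw [Submodule.mem_span_singleton, LinearMap.mem_ker, Matrix.mulVecLin_apply]
    constructor
    · intro hx
      obtain ⟨m, hm⟩ := Finite.exists_max x
      refine ⟨x m, ?_⟩
      have hall : Finset.univ.filter (fun i => x i = x m) = Finset.univ := by
        by_contra hS
        obtain ⟨i, hi, j, hj, hij⟩ := hirr _ (Finset.subset_univ _)
          ⟨m, by simp⟩ hS
        have hi' : x i = x m := by simpa using hi
        have hj' : x j ≠ x m := by simpa using hj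
        have hlt : x j < x m := lt_of_le_of_ne (hm j) hj'
        have hsum : ∑ l, M i l * (x l - x m) = 0 := by
          have h1 : ∑ l, M i l * x l = 0 := congrFun hx i
          simp only [mul_sub, Finset.sum_sub_distrib, ← Finset.sum_mul, h1, hrow i]
          simp
        have hnn : ∀ l ∈ Finset.univ, 0 ≤ M i l * (x l - x m) := by
          intro l _
          by_cases h : i = l
          · subst h
            simp [hi']
          · exact mul_nonneg_of_nonpos_of_nonpos (hoff i l h) (sub_nonpos.2 (hm l))
        have h0 := (Finset.sum_eq_zero_iff_of_nonneg hnn).1 hsum j (Finset.mem_univ j)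
        rcases mul_eq_zero.1 h0 with h | h
        · exact hij h
        · linarith
      ext i
      have : i ∈ Finset.univ.filter (fun i => x i = x m) := by
        rw [hall]
        exact Finset.mem_univ i
      have h2 : x i = x m := by simpa using this
      simp [h2]
    · rintro ⟨a, rfl⟩
      ext i
      simp [Matrix.mulVec, dotProduct, ← Finset.sum_mul, hrow i]
  refine ⟨hker, ?_⟩
  let φ : (Fin n → ℝ) →ₗ[ℝ] ℝ := ∑ i, LinearMap.proj i
  have hφ : ∀ y, φ y = ∑ i, y i := by
    intro y
    simp [φ]
  have hle : LinearMap.range M.mulVecLin ≤ LinearMap.ker φ := by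
    rintro _ ⟨x, rfl⟩
    rw [LinearMap.mem_ker, hφ]
    simp only [Matrix.mulVecLin_apply, Matrix.mulVec, dotProduct]
    rw [Finset.sum_comm]
    simp [← Finset.sum_mul, hcol]
  have hsurj : LinearMap.range φ = ⊤ := by
    rw [LinearMap.range_eq_top]
    intro c
    refine ⟨Pi.single ⟨0, hn⟩ c, ?_⟩
    rw [hφ]
    simp
  have hr1 := LinearMap.finrank_range_add_finrank_ker M.mulVecLin
  have hr2 := LinearMap.finrank_range_add_finrank_ker φ
  have hone : (fun _ : Fin n => (1 : ℝ)) ≠ 0 := by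
    intro h
    have := congrFun h ⟨0, hn⟩
    simp at this
  rw [hker, finrank_span_singleton hone] at hr1
  rw [hsurj, finrank_top, Module.finrank_self] at hr2
  have heq : LinearMap.range M.mulVecLin = LinearMap.ker φ :=
    Submodule.eq_of_le_of_finrank_eq hle (by omega)
  rw [heq]
  ext y
  simp only [SetLike.mem_coe, LinearMap.mem_ker, hφ, Set.mem_setOf_eq]
end

section
/- Let d ≥ 1, let b : ℝ^d → ℝ^d be measurable, let N ∈ ℝ^d with |N| = 1, and let w : ℝ^d → [0,∞) be integrable with ∫_{ℝ^d} w > 0 and with x ↦ (b(x)·N)·w(x) integrable. Then 0 ≤ I(b,N,w) ≤ (1/∫_{ℝ^d} w) · ∫∫_{ℝ^d×ℝ^d} |b(x) − b(y)|·w(x)·w(y) dx dy, where the double integral on the right is interpreted in [0,∞] and |·| is the Euclidean norm on ℝ^d. -/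
open MeasureTheory
open scoped InnerProductSpace ENNReal

/-- The discrepancy `I(b,N,w)` between the upwind flux coefficient and the positive
part of the averaged flux is nonnegative and bounded by the mean oscillation of `b`. -/
theorem upwind_flux_discrepancy_bound (d : ℕ) (hd : 1 ≤ d)
    (b : EuclideanSpace ℝ (Fin d) → EuclideanSpace ℝ (Fin d)) (hb : Measurable b)
    (N : EuclideanSpace ℝ (Fin d)) (hN : ‖N‖ = 1)
    (w : EuclideanSpace ℝ (Fin d) → ℝ) (hw0 : ∀ x, 0 ≤ w x)
    (hwint : Integrable w) (hwpos : 0 < ∫ x, w x)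
    (hbw : Integrable fun x => ⟪b x, N⟫_ℝ * w x) :
    (0 ≤ (∫ x, max ⟪b x, N⟫_ℝ 0 * w x) - max (∫ x, ⟪b x, N⟫_ℝ * w x) 0) ∧
    ENNReal.ofReal ((∫ x, max ⟪b x, N⟫_ℝ 0 * w x) - max (∫ x, ⟪b x, N⟫_ℝ * w x) 0)
      ≤ ENNReal.ofReal (1 / ∫ x, w x) *
        ∫⁻ x, ∫⁻ y, ENNReal.ofReal (‖b x - b y‖ * w x * w y) := by
  have hmax : ∀ x, max ⟪b x, N⟫_ℝ 0 * w x = max (⟪b x, N⟫_ℝ * w x) 0 := by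
    intro x
    rw [max_mul_of_nonneg _ _ (hw0 x), zero_mul]
  have hPint : Integrable fun x => max ⟪b x, N⟫_ℝ 0 * w x := by
    simp_rw [hmax]
    exact hbw.pos_part
  refine ⟨?_, ?_⟩
  · rw [sub_nonneg]
    refine max_le ?_ ?_
    · exact integral_mono hbw hPint
        (fun x => mul_le_mul_of_nonneg_right (le_max_left _ _) (hw0 x))
    · exact integral_nonneg (fun x => mul_nonneg (le_max_right _ _) (hw0 x))
  set W := ∫ x, w x with hW
  set F := ∫ x, ⟪b x, N⟫_ℝ * w x with hF
  set P := ∫ x, max ⟪b x, N⟫_ℝ 0 * w x with hP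
  have hg : ∫ x, (W * (max ⟪b x, N⟫_ℝ 0 * w x) - max F 0 * w x) = W * (P - max F 0) := by
    rw [integral_sub (hPint.const_mul W) (hwint.const_mul _), integral_const_mul,
      integral_const_mul]
    ring
  have heq : P - max F 0 =
      (1 / W) * ∫ x, (W * (max ⟪b x, N⟫_ℝ 0 * w x) - max F 0 * w x) := by
    rw [hg]
    field_simp
  rw [heq, ENNReal.ofReal_mul (by positivity)]
  gcongr
  refine (Real.ofReal_le_enorm _).trans ((enorm_integral_le_lintegral_enorm _).trans ?_)
  refine lintegral_mono fun x => ?_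
  have hx : ∫ y, (⟪b x, N⟫_ℝ * w x * w y - w x * (⟪b y, N⟫_ℝ * w y))
      = w x * (W * ⟪b x, N⟫_ℝ - F) := by
    rw [integral_sub (hwint.const_mul _) (hbw.const_mul _), integral_const_mul,
      integral_const_mul]
    ring
  have h1 : ‖W * (max ⟪b x, N⟫_ℝ 0 * w x) - max F 0 * w x‖ₑ
      ≤ ‖∫ y, (⟪b x, N⟫_ℝ * w x * w y - w x * (⟪b y, N⟫_ℝ * w y))‖ₑ := by
    rw [hx]
    refine enorm_le_iff_norm_le.2 ?_
    have h2 : W * (max ⟪b x, N⟫_ℝ 0 * w x) - max F 0 * w x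
        = w x * (max (W * ⟪b x, N⟫_ℝ) 0 - max F 0) := by
      have : max (W * ⟪b x, N⟫_ℝ) 0 = W * max ⟪b x, N⟫_ℝ 0 := by
        rw [mul_max_of_nonneg _ _ hwpos.le, mul_zero]
      rw [this]
      ring
    rw [h2, norm_mul, norm_mul]
    gcongr
    exact abs_max_sub_max_le_abs _ _ _
  refine h1.trans ((enorm_integral_le_lintegral_enorm _).trans ?_)
  refine lintegral_mono fun y => ?_
  rw [← ofReal_norm_eq_enorm]
  refine ENNReal.ofReal_le_ofReal ?_
  have h3 : ⟪b x, N⟫_ℝ * w x * w y - w x * (⟪b y, N⟫_ℝ * w y)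
      = ⟪b x - b y, N⟫_ℝ * w x * w y := by
    rw [inner_sub_left]
    ring
  rw [h3, norm_mul, norm_mul, Real.norm_of_nonneg (hw0 x), Real.norm_of_nonneg (hw0 y)]
  have h4 : ‖⟪b x - b y, N⟫_ℝ‖ ≤ ‖b x - b y‖ := by
    simpa [hN] using norm_inner_le_norm (𝕜 := ℝ) (b x - b y) N
  exact mul_le_mul_of_nonneg_right (mul_le_mul_of_nonneg_right h4 (hw0 x)) (hw0 y)
end
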